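/- arXiv:1701.08325 — 2 statements merged into one kernel-verified Lean document; each statement's English description precedes it below -/
import Mathlib

section
/- Let D be a block design with parameters (v, b, r, 3, λ) built on a finite set V (block size k = 3) with λ < v − 2 and b < C(v, 3), and let D' be the block design consisting of all 3-element subsets of V that are not blocks of D. Then D and D' are friends: for every j ≥ 0, z_j(D, B') does not depend on the choice of the block B' of D', and z_j(D', B) does not depend on the choice of the block B of D. In particular z_3(D, B') = 0 for every block B' of D', and z_3(D', B) = 0 for every block B of D. -/
open Finset

variable {V : Type*}

/-- `zval D M j` is the number of blocks `B` of `D` with `|M ∩ B| = j`. -/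
def zval [DecidableEq V] (D : Finset (Finset V)) (M : Finset V) (j : ℕ) : ℕ :=
  (D.filter fun B => (M ∩ B).card = j).card

/-- A (simple) balanced incomplete block design with parameters `(v, b, r, k, lam)`
built on the finite set `V`. -/
structure IsBIBD [Fintype V] [DecidableEq V] (D : Finset (Finset V))
    (v b r k lam : ℕ) : Prop where
  card_pts : Fintype.card V = v
  card_blocks : D.card = b
  block_size : ∀ B ∈ D, B.card = k
  repl : ∀ x : V, (D.filter fun B => x ∈ B).card = r
  balance : ∀ x y : V, x ≠ y → (D.filter fun B => x ∈ B ∧ y ∈ B).card = lam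

/-- Two block designs on the same set `V` are friends if, for every `j`,
`zval D₁ B₂ j` does not depend on the choice of block `B₂` of `D₂`, and
`zval D₂ B₁ j` does not depend on the choice of block `B₁` of `D₁`. -/
def IsFriends [DecidableEq V] (D₁ D₂ : Finset (Finset V)) : Prop :=
  (∀ j : ℕ, ∀ B ∈ D₂, ∀ B' ∈ D₂, zval D₁ B j = zval D₁ B' j) ∧
  (∀ j : ℕ, ∀ B ∈ D₁, ∀ B' ∈ D₁, zval D₂ B j = zval D₂ B' j)

/-- A triple contained in a block of size three meets it in three points only if they coincide. -/
theorem zval_three_eq_zero [DecidableEq V] {D : Finset (Finset V)} {M : Finset V}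
    (hD : ∀ B ∈ D, B.card = 3) (hM : M.card = 3) (hMD : M ∉ D) : zval D M 3 = 0 := by
  rw [zval, card_eq_zero, filter_eq_empty_iff]
  intro B hB h
  have h₁ : M ∩ B = M := eq_of_subset_of_card_le inter_subset_left (by omega)
  have h₂ : M ∩ B = B := eq_of_subset_of_card_le inter_subset_right (by rw [hD B hB, h])
  exact hMD (by rwa [← h₁, h₂])

/-- The only block of size three meeting a block `M` of size three in three points is `M`. -/
theorem zval_three_eq_one [DecidableEq V] {D : Finset (Finset V)} {M : Finset V}
    (hD : ∀ B ∈ D, B.card = 3) (hMD : M ∈ D) : zval D M 3 = 1 := by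
  have hM := hD M hMD
  rw [zval, card_eq_one]
  refine ⟨M, ?_⟩
  ext B
  simp only [mem_filter, mem_singleton]
  constructor
  · rintro ⟨hB, h⟩
    have h₁ : M ∩ B = M := eq_of_subset_of_card_le inter_subset_left (by omega)
    have h₂ : M ∩ B = B := eq_of_subset_of_card_le inter_subset_right (by rw [hD B hB, h])
    rw [← h₂, h₁]
  · rintro rfl
    exact ⟨hMD, by rwa [inter_self]⟩

theorem card_triple_inter [DecidableEq V] {a b c : V} (hab : a ≠ b) (hac : a ≠ c) (hbc : b ≠ c)
    (B : Finset V) : (({a, b, c} : Finset V) ∩ B).card =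
      (if a ∈ B then 1 else 0) + (if b ∈ B then 1 else 0) + (if c ∈ B then 1 else 0) := by
  by_cases ha : a ∈ B <;> by_cases hb : b ∈ B <;> by_cases hc : c ∈ B <;>
    simp [insert_inter_of_mem, insert_inter_of_notMem, ha, hb, hc, hab, hac, hbc]

/-- The counting equations for the intersection numbers of a `3`-subset with a design. -/
theorem IsBIBD.zval_equations [Fintype V] [DecidableEq V] {D : Finset (Finset V)}
    {v b r k lam : ℕ} (hD : IsBIBD D v b r k lam) {M : Finset V} (hM : M.card = 3) :
    zval D M 0 + zval D M 1 + zval D M 2 + zval D M 3 = b ∧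
    zval D M 1 + 2 * zval D M 2 + 3 * zval D M 3 = 3 * r ∧
    zval D M 2 + 3 * zval D M 3 = 3 * lam := by
  obtain ⟨x, y, z, hxy, hxz, hyz, rfl⟩ := card_eq_three.mp hM
  refine ⟨?_, ?_, ?_⟩
  · rw [← hD.card_blocks, card_eq_sum_ones]
    simp only [zval, card_filter, ← sum_add_distrib, card_triple_inter hxy hxz hyz]
    refine sum_congr rfl fun B _ => ?_
    split_ifs <;> simp_all
  · have h : 3 * r = r + r + r := by ring
    rw [h]
    nth_rewrite 1 [← hD.repl x]
    nth_rewrite 1 [← hD.repl y]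
    rw [← hD.repl z]
    simp only [zval, card_filter, ← sum_add_distrib, mul_sum, card_triple_inter hxy hxz hyz]
    refine sum_congr rfl fun B _ => ?_
    split_ifs <;> simp_all
  · have h : 3 * lam = lam + lam + lam := by ring
    rw [h]
    nth_rewrite 1 [← hD.balance x y hxy]
    nth_rewrite 1 [← hD.balance x z hxz]
    rw [← hD.balance y z hyz]
    simp only [zval, card_filter, ← sum_add_distrib, mul_sum, card_triple_inter hxy hxz hyz]
    refine sum_congr rfl fun B _ => ?_
    split_ifs <;> simp_all

theorem zval_eq_zero_of_card_lt [DecidableEq V] {D : Finset (Finset V)} {M : Finset V} {j : ℕ}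
    (h : M.card < j) : zval D M j = 0 := by
  rw [zval, card_eq_zero, filter_eq_empty_iff]
  intro B _ hB
  have := card_le_card (inter_subset_left (s₁ := M) (s₂ := B))
  omega

/-- In a design the intersection numbers of a `3`-subset are determined by the last one. -/
theorem IsBIBD.zval_eq_of_zval_three_eq [Fintype V] [DecidableEq V] {D : Finset (Finset V)}
    {v b r k lam : ℕ} (hD : IsBIBD D v b r k lam) {M N : Finset V} (hM : M.card = 3)
    (hN : N.card = 3) (h : zval D M 3 = zval D N 3) (j : ℕ) : zval D M j = zval D N j := by
  obtain ⟨h₁, h₂, h₃⟩ := hD.zval_equations hM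
  obtain ⟨h₁', h₂', h₃'⟩ := hD.zval_equations hN
  rcases lt_or_ge 3 j with hj | hj
  · rw [zval_eq_zero_of_card_lt (by omega), zval_eq_zero_of_card_lt (by omega)]
  · interval_cases j <;> omega

/-- The intersection numbers of a set with all `k`-subsets depend only on its cardinality. -/
theorem zval_powersetCard_univ_eq [Fintype V] [DecidableEq V] (k : ℕ) {M N : Finset V}
    (h : M.card = N.card) (j : ℕ) :
    zval (powersetCard k (univ : Finset V)) M j =
      zval (powersetCard k (univ : Finset V)) N j := by
  let e : Equiv.Perm V := (Finset.equivOfCardEq h).extendSubtype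
  have he : M.map e.toEmbedding = N := by
    refine eq_of_subset_of_card_le ?_ (by rw [card_map, h])
    intro x hx
    obtain ⟨y, hy, rfl⟩ := mem_map.mp hx
    exact (Finset.equivOfCardEq h).extendSubtype_mem y hy
  refine card_equiv e.finsetCongr fun B => ?_
  simp only [mem_filter, mem_powersetCard_univ, Equiv.finsetCongr_apply, card_map]
  rw [← he, ← map_inter, card_map]

theorem zval_sdiff_add [DecidableEq V] {D E : Finset (Finset V)} (h : D ⊆ E) (M : Finset V)
    (j : ℕ) : zval (E \ D) M j + zval D M j = zval E M j := by
  simp only [zval, card_filter]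
  exact sum_sdiff h

theorem stmt_15 [Fintype V] [DecidableEq V] (D : Finset (Finset V))
    (v b r lam : ℕ) (hD : IsBIBD D v b r 3 lam)
    (hlam : lam < v - 2) (hb : b < v.choose 3) :
    IsFriends D ((Finset.powersetCard 3 (Finset.univ : Finset V)) \ D) ∧
    (∀ B' ∈ (Finset.powersetCard 3 (Finset.univ : Finset V)) \ D,
      zval D B' 3 = 0) ∧
    (∀ B ∈ D,
      zval ((Finset.powersetCard 3 (Finset.univ : Finset V)) \ D) B 3 = 0) := by
  have hsize := hD.block_size
  have hsub : D ⊆ powersetCard 3 (univ : Finset V) := fun B hB =>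
    mem_powersetCard_univ.mpr (hsize B hB)
  have hmem : ∀ B ∈ powersetCard 3 (univ : Finset V) \ D, B.card = 3 ∧ B ∉ D := fun B hB => by
    simpa using hB
  have hzero : ∀ B ∈ powersetCard 3 (univ : Finset V) \ D, zval D B 3 = 0 := fun B hB =>
    zval_three_eq_zero hsize (hmem B hB).1 (hmem B hB).2
  refine ⟨⟨fun j B hB B' hB' => ?_, fun j B hB B' hB' => ?_⟩, hzero, fun B hB => ?_⟩
  · exact hD.zval_eq_of_zval_three_eq (hmem B hB).1 (hmem B' hB').1
      (by rw [hzero B hB, hzero B' hB']) j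
  · have h := hD.zval_eq_of_zval_three_eq (hsize B hB) (hsize B' hB')
      (by rw [zval_three_eq_one hsize hB, zval_three_eq_one hsize hB']) j
    have hT := zval_powersetCard_univ_eq 3 ((hsize B hB).trans (hsize B' hB').symm) j
    have h₁ := zval_sdiff_add hsub B j
    have h₂ := zval_sdiff_add hsub B' j
    omega
  · exact zval_three_eq_zero (fun C hC => (hmem C hC).1) (hsize B hB)
      fun h => (hmem B h).2 hB
end

section
/- Let D be a block design with parameters (v, b, r, 3, 1) built on a finite set V (block size k = 3 and λ = 1), with v ≥ 4, and suppose the collection D₂^{(4)} of all 4-element subsets of V containing no block of D is nonempty. Then D₂^{(4)} is a block design on V with parameters (v, C(v, 4) − b(v − 3), C(v − 1, 3) − r(v − 3) − (b − r), 4, C(v − 2, 2) − (v − 3) − 2(r − 1)). -/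
open Finset

variable {V : Type*}

theorem IsBIBD.eq_of_subset_of_card_eq_four [Fintype V] [DecidableEq V] {D : Finset (Finset V)}
    {v b r : ℕ} (hD : IsBIBD D v b r 3 1) {B B' T : Finset V} (hB : B ∈ D) (hB' : B' ∈ D)
    (hT : T.card = 4) (h : B ⊆ T) (h' : B' ⊆ T) : B = B' := by
  have h1 := card_union_add_card_inter B B'
  have h2 := card_le_card (union_subset h h')
  rw [hD.block_size B hB, hD.block_size B' hB'] at h1
  obtain ⟨x, hx, y, hy, hxy⟩ := one_lt_card.1 (show 1 < (B ∩ B').card by omega)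
  rw [mem_inter] at hx hy
  exact card_le_one.1 (hD.balance x y hxy).le B (mem_filter.2 ⟨hB, hx.1, hy.1⟩)
    B' (mem_filter.2 ⟨hB', hx.2, hy.2⟩)

/-- The number of block-free 4-sets containing `S`, together with the numbers of 4-sets containing
`S` and a given block, gives the number of all 4-sets containing `S`. -/
theorem IsBIBD.card_blockFree_add_sum [Fintype V] [DecidableEq V] {D : Finset (Finset V)}
    {v b r : ℕ} (hD : IsBIBD D v b r 3 1) (S : Finset V) (hS : S.card ≤ 4) :
    (((powersetCard 4 (univ : Finset V)).filter fun T => ∀ B ∈ D, ¬ B ⊆ T).filter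
        (S ⊆ ·)).card +
      ∑ B ∈ D, ((powersetCard 4 (univ : Finset V)).filter (B ∪ S ⊆ ·)).card =
      (v - S.card).choose (4 - S.card) := by
  rw [← hD.card_pts, ← card_univ,
    ← card_filter_powersetCard_subset S univ 4 (subset_univ S) hS, ← card_biUnion,
    ← card_union_of_disjoint]
  · congr 1
    ext T
    simp only [mem_union, mem_filter, mem_biUnion, union_subset_iff]
    grind
  · rw [disjoint_left]
    intro T hT hT'
    simp only [mem_filter, mem_biUnion, union_subset_iff] at hT hT'
    grind
  · intro B hB B' hB' hne
    rw [Function.onFun, disjoint_left]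
    intro T hT hT'
    simp only [mem_filter, mem_powersetCard, union_subset_iff] at hT hT'
    exact hne (hD.eq_of_subset_of_card_eq_four hB hB' hT.1.2 hT.2.1 hT'.2.1)

theorem stmt_18 [Fintype V] [DecidableEq V] (D : Finset (Finset V))
    (v b r : ℕ) (hD : IsBIBD D v b r 3 1) (hv : 4 ≤ v)
    (hne : ((Finset.powersetCard 4 (Finset.univ : Finset V)).filter
        fun T => ∀ B ∈ D, ¬ B ⊆ T).Nonempty) :
    IsBIBD ((Finset.powersetCard 4 (Finset.univ : Finset V)).filter
        fun T => ∀ B ∈ D, ¬ B ⊆ T)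
      v (v.choose 4 - b * (v - 3))
      ((v - 1).choose 3 - r * (v - 3) - (b - r)) 4
      ((v - 2).choose 2 - (v - 3) - 2 * (r - 1)) := by
  have hV := hD.card_pts
  have three (U : Finset V) (hU : U.card = 3) :
      ((powersetCard 4 (univ : Finset V)).filter (U ⊆ ·)).card = v - 3 := by
    rw [card_filter_powersetCard_subset U univ 4 (subset_univ U) (by omega), hU, card_univ, hV]
    simp
  have four (U : Finset V) (hU : U.card = 4) :
      ((powersetCard 4 (univ : Finset V)).filter (U ⊆ ·)).card = 1 := by
    rw [card_filter_powersetCard_subset U univ 4 (subset_univ U) (by omega), hU]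
    simp
  have five (U : Finset V) (hU : 4 < U.card) :
      ((powersetCard 4 (univ : Finset V)).filter (U ⊆ ·)).card = 0 := by
    rw [card_eq_zero, filter_eq_empty_iff]
    intro T hT h
    have := card_le_card h
    rw [(mem_powersetCard.1 hT).2] at this
    omega
  refine ⟨hV, ?_, ?_, ?_, ?_⟩
  · have h := hD.card_blockFree_add_sum ∅ (by simp)
    rw [sum_congr rfl fun B hB => three (B ∪ ∅) (by simpa using hD.block_size B hB)] at h
    simp only [empty_subset, filter_true, sum_const, smul_eq_mul, card_empty, hD.card_blocks,
      Nat.sub_zero] at h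
    omega
  · intro B hB
    exact (mem_powersetCard.1 (mem_filter.1 hB).1).2
  · intro x
    have h := hD.card_blockFree_add_sum {x} (by simp)
    have hr := hD.repl x
    have hs := card_filter_add_card_filter_not (s := D) (fun B => x ∈ B)
    rw [hD.card_blocks, hr] at hs
    have key : ∀ B ∈ D, ((powersetCard 4 (univ : Finset V)).filter (B ∪ {x} ⊆ ·)).card =
        (if x ∈ B then 1 else 0) * (v - 3) + (if x ∉ B then 1 else 0) := by
      intro B hB
      have hc := hD.block_size B hB
      by_cases hx : x ∈ B
      · rw [three _ (by rwa [union_eq_left.2 (by simpa using hx)])]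
        simp [hx]
      · rw [four _ (by rw [card_union_of_disjoint (by simpa using hx), hc, card_singleton])]
        simp [hx]
    rw [sum_congr rfl key, sum_add_distrib, ← sum_mul, ← card_filter, ← card_filter, hr] at h
    simp only [singleton_subset_iff, card_singleton] at h
    norm_num at h
    omega
  · intro x y hxy
    have h := hD.card_blockFree_add_sum {x, y} (by simp [card_pair hxy])
    have hb := hD.balance x y hxy
    have hx := card_filter_add_card_filter_not (s := D.filter (x ∈ ·)) (fun B => y ∈ B)
    have hy := card_filter_add_card_filter_not (s := D.filter (y ∈ ·)) (fun B => x ∈ B)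
    simp only [filter_filter] at hx hy
    rw [hD.repl, hb] at hx
    rw [hD.repl, filter_congr (fun B _ => and_comm), hb] at hy
    have key : ∀ B ∈ D, ((powersetCard 4 (univ : Finset V)).filter (B ∪ {x, y} ⊆ ·)).card =
        (if x ∈ B ∧ y ∈ B then 1 else 0) * (v - 3) + (if x ∈ B ∧ y ∉ B then 1 else 0) +
          (if y ∈ B ∧ x ∉ B then 1 else 0) := by
      intro B hB
      have hc := hD.block_size B hB
      have hu : B ∪ {x, y} = insert x (insert y B) := by grind
      rw [hu]
      by_cases hx : x ∈ B <;> by_cases hy : y ∈ B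
      · rw [three _ (by simpa [hx, hy] using hc)]
        simp [hx, hy]
      · rw [four _ (by grind)]
        simp [hx, hy]
      · rw [four _ (by grind)]
        simp [hx, hy]
      · rw [five _ (by grind)]
        simp [hx, hy]
    rw [sum_congr rfl key, sum_add_distrib, sum_add_distrib, ← sum_mul, ← card_filter,
      ← card_filter, ← card_filter, hb] at h
    simp only [insert_subset_iff, singleton_subset_iff, card_pair hxy] at h
    norm_num at h
    omega
end
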